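/- Let U be an open subset of {(r,θ) ∈ ℝ² : r > 0} and let u : U → ℂ be smooth and satisfy the polar Liouville equation u_rr + (1/r)u_r + (1/r²)u_θθ = 8e^u on U. Then for every λ ∈ ℂ with λ ≠ 0, the zero-curvature condition ∂_θ L(λ) − ∂_r A(λ) + L(λ)·A(λ) − A(λ)·L(λ) = 0 holds (as an identity of 2×2 complex matrices) at every point of U. -/

import Mathlib

/-- Partial derivative in the first (radial) variable. -/
noncomputable def pdr (f : ℝ × ℝ → ℂ) (p : ℝ × ℝ) : ℂ := fderiv ℝ f p (1, 0)

/-- Partial derivative in the second (angular) variable. -/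
noncomputable def pdt (f : ℝ × ℝ → ℂ) (p : ℝ × ℝ) : ℂ := fderiv ℝ f p (0, 1)

/-- The matrix `L(λ)` of the Lax pair of the polar Liouville equation. -/
noncomputable def Lmat (u : ℝ × ℝ → ℂ) (lam : ℂ) (p : ℝ × ℝ) : Matrix (Fin 2) (Fin 2) ℂ :=
  !![Complex.exp (u p + Complex.I * p.2) / (2 * lam) + lam * Complex.exp (-(Complex.I * p.2)),
     -Complex.exp (u p + Complex.I * p.2) / (2 * lam) + pdr u p / 4
       + Complex.I / (4 * p.1) * pdt u p;
     Complex.exp (u p + Complex.I * p.2) / (2 * lam) + pdr u p / 4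
       + Complex.I / (4 * p.1) * pdt u p,
     -Complex.exp (u p + Complex.I * p.2) / (2 * lam) - lam * Complex.exp (-(Complex.I * p.2))]

/-- The matrix `A(λ)` of the Lax pair of the polar Liouville equation. -/
noncomputable def Amat (u : ℝ × ℝ → ℂ) (lam : ℂ) (p : ℝ × ℝ) : Matrix (Fin 2) (Fin 2) ℂ :=
  (Complex.I * p.1) •
  !![Complex.exp (u p + Complex.I * p.2) / (2 * lam) - lam * Complex.exp (-(Complex.I * p.2)),
     -Complex.exp (u p + Complex.I * p.2) / (2 * lam) - pdr u p / 4
       - Complex.I / (4 * p.1) * pdt u p;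
     Complex.exp (u p + Complex.I * p.2) / (2 * lam) - pdr u p / 4
       - Complex.I / (4 * p.1) * pdt u p,
     -Complex.exp (u p + Complex.I * p.2) / (2 * lam) + lam * Complex.exp (-(Complex.I * p.2))]

/-- Entrywise partial derivative in `r` of a matrix-valued function. -/
noncomputable def pdrM (F : ℝ × ℝ → Matrix (Fin 2) (Fin 2) ℂ) (p : ℝ × ℝ) :
    Matrix (Fin 2) (Fin 2) ℂ :=
  Matrix.of fun i j => pdr (fun q => F q i j) p

/-- Entrywise partial derivative in `θ` of a matrix-valued function. -/
noncomputable def pdtM (F : ℝ × ℝ → Matrix (Fin 2) (Fin 2) ℂ) (p : ℝ × ℝ) :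
    Matrix (Fin 2) (Fin 2) ℂ :=
  Matrix.of fun i j => pdt (fun q => F q i j) p

lemma hasDerivAt_pdr {f : ℝ × ℝ → ℂ} {p : ℝ × ℝ} (hf : DifferentiableAt ℝ f p) :
    HasDerivAt (fun r : ℝ => f (r, p.2)) (pdr f p) p.1 :=
  HasFDerivAt.comp_hasDerivAt p.1 (f := fun r : ℝ => (r, p.2)) hf.hasFDerivAt
    ((hasDerivAt_id p.1).prodMk (hasDerivAt_const p.1 p.2))

lemma hasDerivAt_pdt {f : ℝ × ℝ → ℂ} {p : ℝ × ℝ} (hf : DifferentiableAt ℝ f p) :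
    HasDerivAt (fun θ : ℝ => f (p.1, θ)) (pdt f p) p.2 :=
  HasFDerivAt.comp_hasDerivAt p.2 (f := fun θ : ℝ => (p.1, θ)) hf.hasFDerivAt
    ((hasDerivAt_const p.2 p.1).prodMk (hasDerivAt_id p.2))

lemma ContDiffAt.differentiableAt_fderiv_apply {f : ℝ × ℝ → ℂ} {p : ℝ × ℝ}
    (hf : ContDiffAt ℝ 2 f p) (v : ℝ × ℝ) :
    DifferentiableAt ℝ (fun q => fderiv ℝ f q v) p :=
  ((hf.fderiv_right (m := 1) (by norm_num)).differentiableAt (by norm_num)).clm_apply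
    (differentiableAt_const v)

/-- Mixed partial derivatives of a `C²` function commute. -/
lemma pdr_pdt_comm {f : ℝ × ℝ → ℂ} {p : ℝ × ℝ} (hf : ContDiffAt ℝ 2 f p) :
    pdr (pdt f) p = pdt (pdr f) p := by
  have hd : DifferentiableAt ℝ (fderiv ℝ f) p :=
    (hf.fderiv_right (m := 1) (by norm_num)).differentiableAt (by norm_num)
  have hs := hf.isSymmSndFDerivAt (by simp)
  have key (v w : ℝ × ℝ) : fderiv ℝ (fun q => fderiv ℝ f q v) p w
      = fderiv ℝ (fderiv ℝ f) p w v := by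
    rw [fderiv_clm_apply hd (differentiableAt_const v)]
    simp
  change fderiv ℝ (fun q => fderiv ℝ f q (0, 1)) p (1, 0)
    = fderiv ℝ (fun q => fderiv ℝ f q (1, 0)) p (0, 1)
  rw [key, key]
  exact hs _ _

/-- If `u` is smooth on an open set `U ⊆ {r > 0}` and satisfies the polar Liouville
equation `u_rr + (1/r) u_r + (1/r²) u_θθ = 8 e^u` there, then for every `λ ≠ 0` the
zero-curvature condition `∂_θ L(λ) − ∂_r A(λ) + L(λ)A(λ) − A(λ)L(λ) = 0` holds on `U`. -/
theorem liouville_zero_curvature (U : Set (ℝ × ℝ)) (hUopen : IsOpen U)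
    (hUpos : ∀ p ∈ U, 0 < p.1) (u : ℝ × ℝ → ℂ) (hu : ContDiffOn ℝ (⊤ : ℕ∞) u U)
    (hLiou : ∀ p ∈ U,
      pdr (pdr u) p + (1 / (p.1 : ℂ)) * pdr u p + (1 / (p.1 : ℂ) ^ 2) * pdt (pdt u) p
        = 8 * Complex.exp (u p))
    (lam : ℂ) (hlam : lam ≠ 0) :
    ∀ p ∈ U,
      pdtM (Lmat u lam) p - pdrM (Amat u lam) p
        + Lmat u lam p * Amat u lam p - Amat u lam p * Lmat u lam p = 0 := by
  intro p hp
  have hu2 : ContDiffAt ℝ 2 u p :=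
    (hu.contDiffAt (hUopen.mem_nhds hp)).of_le (WithTop.coe_le_coe.2 le_top)
  have hr : (p.1 : ℂ) ≠ 0 := by exact_mod_cast (hUpos p hp).ne'
  have du : DifferentiableAt ℝ u p := hu2.differentiableAt (by norm_num)
  have dur : DifferentiableAt ℝ (pdr u) p := hu2.differentiableAt_fderiv_apply (1, 0)
  have dut : DifferentiableAt ℝ (pdt u) p := hu2.differentiableAt_fderiv_apply (0, 1)
  have hc := pdr_pdt_comm hu2
  have hL := hLiou p hp
  -- the building blocks of the entries
  set E : ℝ × ℝ → ℂ := fun q => Complex.exp (u q + Complex.I * q.2) / (2 * lam) with hE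
  set M : ℝ × ℝ → ℂ := fun q => lam * Complex.exp (-(Complex.I * q.2)) with hM
  set s : ℝ × ℝ → ℂ := fun q => pdr u q / 4 + Complex.I / (4 * q.1) * pdt u q with hs
  have dfst : DifferentiableAt ℝ (fun q : ℝ × ℝ => (q.1 : ℂ)) p :=
    Complex.ofRealCLM.differentiableAt.comp p differentiableAt_fst
  have dsnd : DifferentiableAt ℝ (fun q : ℝ × ℝ => (q.2 : ℂ)) p :=
    Complex.ofRealCLM.differentiableAt.comp p differentiableAt_snd
  have dE : DifferentiableAt ℝ E p := by
    simp only [hE, div_eq_mul_inv]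
    exact ((du.add (dsnd.const_mul _)).cexp).mul_const _
  have dM : DifferentiableAt ℝ M p := ((dsnd.const_mul _).neg.cexp).const_mul _
  have ds : DifferentiableAt ℝ s p := by
    simp only [hs, div_eq_mul_inv]
    exact (dur.mul_const _).add ((((dfst.const_mul _).inv (by simp [hr])).const_mul _).mul dut)
  have cr : HasDerivAt (fun r : ℝ => (r : ℂ)) 1 p.1 := Complex.ofRealCLM.hasDerivAt
  have ct : HasDerivAt (fun t : ℝ => (t : ℂ)) 1 p.2 := Complex.ofRealCLM.hasDerivAt
  have Er : pdr E p = E p * pdr u p := by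
    refine (hasDerivAt_pdr dE).unique (HasDerivAt.congr_deriv
      (((hasDerivAt_pdr du).add_const (Complex.I * p.2)).cexp.div_const (2 * lam)) ?_)
    exact mul_div_right_comm _ _ _
  have Et : pdt E p = E p * (pdt u p + Complex.I) := by
    refine (hasDerivAt_pdt dE).unique (HasDerivAt.congr_deriv
      (((hasDerivAt_pdt du).add (ct.const_mul Complex.I)).cexp.div_const (2 * lam)) ?_)
    rw [mul_one]
    exact mul_div_right_comm _ _ _
  have Mr : pdr M p = 0 := (hasDerivAt_pdr dM).unique (hasDerivAt_const p.1 (M p))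
  have Mt : pdt M p = -Complex.I * M p := by
    refine (hasDerivAt_pdt dM).unique (HasDerivAt.congr_deriv
      ((ct.const_mul Complex.I).neg.cexp.const_mul lam) ?_)
    rw [mul_one, mul_comm (-Complex.I)]
    exact (mul_assoc _ _ _).symm
  have sr : pdr s p = pdr (pdr u) p / 4 - Complex.I / (4 * p.1 ^ 2) * pdt u p
      + Complex.I / (4 * p.1) * pdr (pdt u) p := by
    refine (hasDerivAt_pdr ds).unique (HasDerivAt.congr_deriv
      (((hasDerivAt_pdr dur).div_const 4).add
      (((hasDerivAt_const p.1 Complex.I).div (cr.const_mul 4) (by simp [hr])).mul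
        (hasDerivAt_pdr dut))) ?_)
    simp only [Pi.div_apply, Prod.mk.eta]
    field_simp
    ring
  have st : pdt s p = pdt (pdr u) p / 4 + Complex.I / (4 * p.1) * pdt (pdt u) p := by
    exact (hasDerivAt_pdt ds).unique (((hasDerivAt_pdt dur).div_const 4).add
      ((hasDerivAt_pdt dut).const_mul (Complex.I / (4 * p.1))))
  have hLm : Lmat u lam = fun q => !![E q + M q, -E q + s q; E q + s q, -E q - M q] := by
    ext q i j; fin_cases i <;> fin_cases j <;> simp [Lmat, E, M, s, add_assoc, neg_div]
  have hAm : Amat u lam = fun q => !![Complex.I * q.1 * (E q - M q), Complex.I * q.1 * (-E q - s q);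
      Complex.I * q.1 * (E q - s q), Complex.I * q.1 * (-E q + M q)] := by
    ext q i j; fin_cases i <;> fin_cases j <;> simp [Amat, E, M, s, sub_sub, neg_div]
  have EM : E p * M p = Complex.exp (u p) / 2 := by
    have : Complex.exp (u p) = Complex.exp (u p + Complex.I * p.2) *
        Complex.exp (-(Complex.I * p.2)) := by rw [← Complex.exp_add]; ring_nf
    simp only [hE, hM, this]
    field_simp
  -- Leibniz rule for the entries of `A`
  have pr (a b : ℂ) (f g : ℝ × ℝ → ℂ) (df : DifferentiableAt ℝ f p)
      (dg : DifferentiableAt ℝ g p) : pdr (fun q => Complex.I * q.1 * (a * f q + b * g q)) p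
      = Complex.I * (a * f p + b * g p) + Complex.I * p.1 * (a * pdr f p + b * pdr g p) := by
    refine (hasDerivAt_pdr ((dfst.const_mul _).mul
      ((df.const_mul a).add (dg.const_mul b)))).unique (HasDerivAt.congr_deriv
      ((cr.const_mul Complex.I).mul
        (((hasDerivAt_pdr df).const_mul a).add ((hasDerivAt_pdr dg).const_mul b))) ?_)
    simp
  have pt (a b : ℂ) (f g : ℝ × ℝ → ℂ) (df : DifferentiableAt ℝ f p)
      (dg : DifferentiableAt ℝ g p) : pdt (fun q => a * f q + b * g q) p
      = a * pdt f p + b * pdt g p :=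
    (hasDerivAt_pdt ((df.const_mul a).add (dg.const_mul b))).unique
      (((hasDerivAt_pdt df).const_mul a).add ((hasDerivAt_pdt dg).const_mul b))
  have r1 := pr 1 (-1) E M dE dM
  have r2 := pr (-1) (-1) E s dE ds
  have r3 := pr 1 (-1) E s dE ds
  have r4 := pr (-1) 1 E M dE dM
  have t1 := pt 1 1 E M dE dM
  have t2 := pt (-1) 1 E s dE ds
  have t3 := pt 1 1 E s dE ds
  have t4 := pt (-1) (-1) E M dE dM
  simp only [one_mul, neg_one_mul, ← sub_eq_add_neg, Er, Et, Mr, Mt, sr, st, hc]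
    at r1 r2 r3 r4 t1 t2 t3 t4
  have hsp : s p = pdr u p / 4 + Complex.I / (4 * p.1) * pdt u p := rfl
  have hI := Complex.I_sq
  have hk : pdr (pdr u) p = 16 * (E p * M p) - pdr u p / p.1 - pdt (pdt u) p / p.1 ^ 2 := by
    rw [EM]; linear_combination hL
  clear_value E M s
  have hT : pdtM (Lmat u lam) p = !![pdt (fun q => E q + M q) p, pdt (fun q => -E q + s q) p;
      pdt (fun q => E q + s q) p, pdt (fun q => -E q - M q) p] := by
    rw [hLm]; ext i j; fin_cases i <;> fin_cases j <;> rfl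
  have hR : pdrM (Amat u lam) p = !![pdr (fun q => Complex.I * q.1 * (E q - M q)) p,
      pdr (fun q => Complex.I * q.1 * (-E q - s q)) p;
      pdr (fun q => Complex.I * q.1 * (E q - s q)) p,
      pdr (fun q => Complex.I * q.1 * (-E q + M q)) p] := by
    rw [hAm]; ext i j; fin_cases i <;> fin_cases j <;> rfl
  rw [hT, hR, hLm, hAm, r1, r2, r3, r4, t1, t2, t3, t4, hk]
  ext i j
  fin_cases i <;> fin_cases j <;>
    simp [hsp] <;> field_simp <;> ring_nf <;> simp only [hI] <;> ring
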